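/- Let n ≥ 1, and let P, Q ∈ Pauli(n) be Pauli operators such that P² = Q² = I and P, Q anticommute. Then there exists a Clifford operator C ∈ Clifford(n) such that C P C⁻¹ = I ⊗ ⋯ ⊗ I ⊗ Z and C Q C⁻¹ = I ⊗ ⋯ ⊗ I ⊗ X (with Z, respectively X, on the last qubit and identity elsewhere). -/

import Mathlib

open scoped Matrix Kronecker

noncomputable section

def PX : Matrix (Fin 2) (Fin 2) ℂ := !![0, 1; 1, 0]
def PY : Matrix (Fin 2) (Fin 2) ℂ := !![0, -Complex.I; Complex.I, 0]
def PZ : Matrix (Fin 2) (Fin 2) ℂ := !![1, 0; 0, -1]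
def gH : Matrix (Fin 2) (Fin 2) ℂ := (Real.sqrt 2 : ℂ)⁻¹ • !![1, 1; 1, -1]
def gS : Matrix (Fin 2) (Fin 2) ℂ := !![1, 0; 0, Complex.I]
def gCZ : Matrix (Fin 4) (Fin 4) ℂ :=
  !![1,0,0,0; 0,1,0,0; 0,0,1,0; 0,0,0,-1]
def ω : ℂ := Complex.exp (Complex.I * Real.pi / 4)

/-- Kronecker product of square matrices, with index types flattened to `Fin (m * k)`. -/
def kron' {m k : ℕ} (A : Matrix (Fin m) (Fin m) ℂ) (B : Matrix (Fin k) (Fin k) ℂ) :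
    Matrix (Fin (m * k)) (Fin (m * k)) ℂ :=
  Matrix.reindex finProdFinEquiv finProdFinEquiv (A ⊗ₖ B)

/-- `n`-fold tensor product `P 0 ⊗ P 1 ⊗ ⋯ ⊗ P (n-1)` of 2×2 matrices. -/
def tensorPow : (n : ℕ) → (Fin n → Matrix (Fin 2) (Fin 2) ℂ) →
    Matrix (Fin (2 ^ n)) (Fin (2 ^ n)) ℂ
  | 0, _ => 1
  | n + 1, P =>
      Matrix.reindex (finCongr (pow_succ' 2 n).symm) (finCongr (pow_succ' 2 n).symm)
        (kron' (P 0) (tensorPow n fun i => P i.succ))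

/-- The set of n-qubit Pauli operators: λ • P₁ ⊗ ⋯ ⊗ Pₙ with λ ∈ {1,-1,i,-i},
    Pⱼ ∈ {I, X, Y, Z}. -/
def PauliSet (n : ℕ) : Set (Matrix (Fin (2 ^ n)) (Fin (2 ^ n)) ℂ) :=
  {M | ∃ (lam : ℂ) (P : Fin n → Matrix (Fin 2) (Fin 2) ℂ),
    lam ∈ ({1, -1, Complex.I, -Complex.I} : Set ℂ) ∧
    (∀ i, P i ∈ ({1, PX, PY, PZ} : Set (Matrix (Fin 2) (Fin 2) ℂ))) ∧
    M = lam • tensorPow n P}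

/-- `I_{2^a} ⊗ G ⊗ I_{2^b}`, where `G` acts on `c` qubits and `a + c + b = n`. -/
def embed (a c b n : ℕ) (h : a + c + b = n)
    (G : Matrix (Fin (2 ^ c)) (Fin (2 ^ c)) ℂ) :
    Matrix (Fin (2 ^ n)) (Fin (2 ^ n)) ℂ :=
  Matrix.reindex (finCongr (by subst h; rw [pow_add, pow_add, mul_assoc]))
    (finCongr (by subst h; rw [pow_add, pow_add, mul_assoc]))
    (kron' (1 : Matrix (Fin (2 ^ a)) (Fin (2 ^ a)) ℂ)
      (kron' G (1 : Matrix (Fin (2 ^ b)) (Fin (2 ^ b)) ℂ)))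

/-- Generators of the Clifford group: ω•I, and H, S, CZ applied to (adjacent) qubits. -/
def CliffordGenSet (n : ℕ) : Set (Matrix (Fin (2 ^ n)) (Fin (2 ^ n)) ℂ) :=
  {ω • 1} ∪
  {M | ∃ a b, ∃ h : a + 1 + b = n, M = embed a 1 b n h gH ∨ M = embed a 1 b n h gS} ∪
  {M | ∃ a b, ∃ h : a + 2 + b = n, M = embed a 2 b n h gCZ}

/-- The Clifford group on n qubits, as a subgroup of `GL (2^n) ℂ`. -/
def CliffordGroup (n : ℕ) : Subgroup (GL (Fin (2 ^ n)) ℂ) :=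
  Subgroup.closure
    {u : GL (Fin (2 ^ n)) ℂ | (u : Matrix (Fin (2 ^ n)) (Fin (2 ^ n)) ℂ) ∈ CliffordGenSet n}

/-- The Pauli group on n qubits, as a subgroup of `GL (2^n) ℂ`.
    (Its underlying set of matrices is exactly `PauliSet n`.) -/
def PauliGroup (n : ℕ) : Subgroup (GL (Fin (2 ^ n)) ℂ) :=
  Subgroup.closure
    {u : GL (Fin (2 ^ n)) ℂ | (u : Matrix (Fin (2 ^ n)) (Fin (2 ^ n)) ℂ) ∈ PauliSet n}

/-- Z on the first qubit, identity elsewhere. -/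
def ZFirst (n : ℕ) : Matrix (Fin (2 ^ n)) (Fin (2 ^ n)) ℂ :=
  tensorPow n fun i => if i.val = 0 then PZ else 1

/-- Z on the last qubit, identity elsewhere. -/
def ZLast (n : ℕ) : Matrix (Fin (2 ^ n)) (Fin (2 ^ n)) ℂ :=
  tensorPow n fun i => if i.val = n - 1 then PZ else 1

/-- X on the last qubit, identity elsewhere. -/
def XLast (n : ℕ) : Matrix (Fin (2 ^ n)) (Fin (2 ^ n)) ℂ :=
  tensorPow n fun i => if i.val = n - 1 then PX else 1

theorem tensorPow_one (n : ℕ) : tensorPow n 1 = 1 := by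
  induction n with
  | zero => rfl
  | succ n ih =>
    change Matrix.reindex _ _ (kron' 1 (tensorPow n 1)) = 1
    rw [ih]
    simp [kron']

theorem kron'_mul {m k : ℕ} (A B : Matrix (Fin m) (Fin m) ℂ) (C D : Matrix (Fin k) (Fin k) ℂ) :
    kron' (A * B) (C * D) = kron' A C * kron' B D := by
  simp [kron', Matrix.mul_kronecker_mul, Matrix.submatrix_mul_equiv]

theorem tensorPow_mul {n : ℕ} (P Q : Fin n → Matrix (Fin 2) (Fin 2) ℂ) :
    tensorPow n (P * Q) = tensorPow n P * tensorPow n Q := by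
  induction n with
  | zero => simp [tensorPow]
  | succ n ih =>
    have h : (tensorPow n fun i : Fin n => P i.succ * Q i.succ) =
      (tensorPow n fun i => P i.succ) * tensorPow n fun i => Q i.succ := ih _ _
    simp only [tensorPow, Pi.mul_apply, h, kron'_mul, Matrix.reindex_apply,
      Matrix.submatrix_mul_equiv]

/-- The `i`-th most significant of the `n` binary digits of `x`. -/
def qubitDigit {n : ℕ} (i : Fin n) (x : Fin (2 ^ n)) : Fin 2 :=
  ⟨x / 2 ^ (n - 1 - i) % 2, Nat.mod_lt _ two_pos⟩

theorem Nat.mod_two_pow_div_mod_two {j n : ℕ} (h : j < n) (x : ℕ) :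
    x % 2 ^ n / 2 ^ j % 2 = x / 2 ^ j % 2 := by
  obtain ⟨d, rfl⟩ := Nat.exists_eq_add_of_lt h
  rw [show j + d + 1 = j + (d + 1) by ring, pow_add, Nat.mod_mul_right_div_self,
    Nat.mod_mod_of_dvd _ (dvd_pow_self 2 d.succ_ne_zero)]

theorem tensorPow_apply {n : ℕ} (P : Fin n → Matrix (Fin 2) (Fin 2) ℂ) (x y : Fin (2 ^ n)) :
    tensorPow n P x y = ∏ i, P i (qubitDigit i x) (qubitDigit i y) := by
  induction n with
  | zero =>
    have : Subsingleton (Fin (2 ^ 0)) := inferInstanceAs (Subsingleton (Fin 1))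
    rw [Subsingleton.elim x y, tensorPow, Matrix.one_apply_eq, Finset.univ_eq_empty,
      Finset.prod_empty]
  | succ n ih =>
    have hd : ∀ z : Fin (2 ^ (n + 1)), (z : ℕ) / 2 ^ n < 2 := fun z =>
      Nat.div_lt_of_lt_mul (by rw [← pow_succ]; exact z.2)
    have h0 : ∀ z : Fin (2 ^ (n + 1)),
        (Fin.cast (pow_succ' 2 n) z).divNat = qubitDigit 0 z := fun z => by
      ext
      simp [qubitDigit, Nat.mod_eq_of_lt (hd z)]
    have h1 : ∀ (i : Fin n) (z : Fin (2 ^ (n + 1))),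
        qubitDigit i (Fin.cast (pow_succ' 2 n) z).modNat = qubitDigit i.succ z := fun i z => by
      ext
      simp only [qubitDigit, Fin.modNat, Fin.val_cast, Fin.val_succ]
      rw [Nat.mod_two_pow_div_mod_two (by omega)]
      congr 3
      omega
    rw [Fin.prod_univ_succ]
    change P 0 (Fin.cast (pow_succ' 2 n) x).divNat (Fin.cast (pow_succ' 2 n) y).divNat *
      tensorPow n (fun i => P i.succ) (Fin.cast (pow_succ' 2 n) x).modNat
        (Fin.cast (pow_succ' 2 n) y).modNat = _
    rw [ih, h0, h0]
    simp only [h1]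

theorem tensorPow_smul {n : ℕ} (c : Fin n → ℂ) (P : Fin n → Matrix (Fin 2) (Fin 2) ℂ) :
    tensorPow n (fun i => c i • P i) = (∏ i, c i) • tensorPow n P := by
  ext x y
  simp [tensorPow_apply, Finset.prod_mul_distrib]

theorem embed_tensorPow (a c b : ℕ) (R : Fin c → Matrix (Fin 2) (Fin 2) ℂ) :
    embed a c b (a + c + b) rfl (tensorPow c R) =
      tensorPow (a + c + b) (Fin.append (Fin.append 1 R) 1) := by
  have e : 2 ^ (a + c + b) = 2 ^ a * (2 ^ c * 2 ^ b) := by rw [pow_add, pow_add, mul_assoc]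
  ext x y
  rw [embed, ← tensorPow_one a, ← tensorPow_one b]
  change tensorPow a 1 (Fin.cast e x).divNat (Fin.cast e y).divNat *
    (tensorPow c R (Fin.cast e x).modNat.divNat (Fin.cast e y).modNat.divNat *
      tensorPow b 1 (Fin.cast e x).modNat.modNat (Fin.cast e y).modNat.modNat) = _
  generalize (1 : Fin a → Matrix (Fin 2) (Fin 2) ℂ) = A
  generalize (1 : Fin b → Matrix (Fin 2) (Fin 2) ℂ) = B
  have ha : ∀ (i : Fin a) (z : Fin (2 ^ (a + c + b))),
      qubitDigit i (Fin.cast e z).divNat = qubitDigit ((i.castAdd c).castAdd b) z := fun i z => by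
    ext
    simp only [qubitDigit, Fin.divNat, Fin.val_cast, Fin.val_castAdd]
    rw [← pow_add, Nat.div_div_eq_div_mul, ← pow_add]
    congr 3
    omega
  have hc : ∀ (i : Fin c) (z : Fin (2 ^ (a + c + b))),
      qubitDigit i (Fin.cast e z).modNat.divNat = qubitDigit ((i.natAdd a).castAdd b) z :=
    fun i z => by
    ext
    simp only [qubitDigit, Fin.divNat, Fin.modNat, Fin.val_cast, Fin.val_castAdd, Fin.val_natAdd]
    rw [← pow_add, Nat.div_div_eq_div_mul, ← pow_add, Nat.mod_two_pow_div_mod_two (by omega)]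
    congr 3
    omega
  have hb : ∀ (i : Fin b) (z : Fin (2 ^ (a + c + b))),
      qubitDigit i (Fin.cast e z).modNat.modNat = qubitDigit (i.natAdd (a + c)) z :=
    fun i z => by
    ext
    simp only [qubitDigit, Fin.modNat, Fin.val_cast, Fin.val_natAdd]
    rw [Nat.mod_mul_left_mod, Nat.mod_two_pow_div_mod_two (by omega)]
    congr 3
    omega
  rw [tensorPow_apply, tensorPow_apply, tensorPow_apply, tensorPow_apply, Fin.prod_univ_add,
    Fin.prod_univ_add]
  simp only [ha, hb, hc, Fin.append_left, Fin.append_right, mul_assoc]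

/-- The operator acting as `A` on qubit `k` and as the identity on the other qubits. -/
def site {n : ℕ} (k : Fin n) :
    Matrix (Fin 2) (Fin 2) ℂ →* Matrix (Fin (2 ^ n)) (Fin (2 ^ n)) ℂ where
  toFun A := tensorPow n (Pi.mulSingle k A)
  map_one' := by rw [Pi.mulSingle_one, tensorPow_one]
  map_mul' A B := by rw [Pi.mulSingle_mul, tensorPow_mul]

theorem site_eq_tensorPow {n : ℕ} (k : Fin n) (A : Matrix (Fin 2) (Fin 2) ℂ) :
    site k A = tensorPow n (Pi.mulSingle k A) := rfl

theorem site_smul {n : ℕ} (k : Fin n) (c : ℂ) (A : Matrix (Fin 2) (Fin 2) ℂ) :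
    site k (c • A) = c • site k A := by
  have h : Pi.mulSingle k (c • A) =
      fun i => (Pi.mulSingle k c : Fin n → ℂ) i •
        (Pi.mulSingle k A : Fin n → Matrix (Fin 2) (Fin 2) ℂ) i := by
    funext i
    rcases eq_or_ne i k with rfl | hi
    · simp
    · simp [hi]
  rw [site_eq_tensorPow, site_eq_tensorPow, h, tensorPow_smul, Finset.prod_pi_mulSingle']
  simp

theorem site_neg {n : ℕ} (k : Fin n) (A : Matrix (Fin 2) (Fin 2) ℂ) :
    site k (-A) = -site k A := by
  simpa using site_smul k (-1) A

theorem tensorPow_commute {n : ℕ} {P Q : Fin n → Matrix (Fin 2) (Fin 2) ℂ} (h : Commute P Q) :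
    Commute (tensorPow n P) (tensorPow n Q) := by
  rw [Commute, SemiconjBy, ← tensorPow_mul, ← tensorPow_mul, h.eq]

theorem tensorPow_commute_site {n : ℕ} {P : Fin n → Matrix (Fin 2) (Fin 2) ℂ} {k : Fin n}
    {A : Matrix (Fin 2) (Fin 2) ℂ} (h : Commute (P k) A) :
    Commute (tensorPow n P) (site k A) := by
  refine tensorPow_commute (funext fun i => ?_)
  rcases eq_or_ne i k with rfl | hi
  · simpa using h.eq
  · simp [hi]

theorem site_commute {n : ℕ} {i j : Fin n} (h : i ≠ j) (A B : Matrix (Fin 2) (Fin 2) ℂ) :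
    Commute (site i A) (site j B) :=
  tensorPow_commute_site (by simp [h.symm])

theorem tensorPow_eq_update_mul_site {n : ℕ} (P : Fin n → Matrix (Fin 2) (Fin 2) ℂ) (k : Fin n) :
    tensorPow n P = tensorPow n (Function.update P k 1) * site k (P k) := by
  rw [site_eq_tensorPow, ← tensorPow_mul]
  congr 1
  funext i
  rcases eq_or_ne i k with rfl | hi
  · simp
  · simp [hi]

theorem exists_fin_add_add {a c b : ℕ} (i : Fin (a + c + b)) :
    (∃ j : Fin a, i = (j.castAdd c).castAdd b) ∨ (∃ j : Fin c, i = (j.natAdd a).castAdd b) ∨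
      ∃ j : Fin b, i = j.natAdd (a + c) := by
  induction i using Fin.addCases with
  | left i =>
    induction i using Fin.addCases with
    | left i => exact .inl ⟨i, rfl⟩
    | right i => exact .inr (.inl ⟨i, rfl⟩)
  | right i => exact .inr (.inr ⟨i, rfl⟩)

theorem embed_one {n : ℕ} (a b : ℕ) (h : a + 1 + b = n) (g : Matrix (Fin 2) (Fin 2) ℂ) :
    embed a 1 b n h g = site ⟨a, by omega⟩ g := by
  subst h
  have hg : g = tensorPow 1 fun _ => g := by
    ext x y
    rw [tensorPow_apply]
    fin_cases x <;> fin_cases y <;> simp [qubitDigit]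
  conv_lhs => rw [hg]
  refine (embed_tensorPow a 1 b fun _ => g).trans ?_
  rw [site_eq_tensorPow]
  congr 1
  funext i
  rcases exists_fin_add_add i with ⟨i, rfl⟩ | ⟨i, rfl⟩ | ⟨i, rfl⟩
  · rw [Fin.append_left, Fin.append_left, Pi.mulSingle_eq_of_ne, Pi.one_apply]
    have := i.2
    simp [Fin.ext_iff]; omega
  · rw [Fin.append_left, Fin.append_right]
    have : Fin.castAdd b (Fin.natAdd a i) = ⟨a, by omega⟩ := by ext; simp
    rw [this, Pi.mulSingle_eq_same]
  · rw [Fin.append_right, Pi.mulSingle_eq_of_ne, Pi.one_apply]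
    simp [Fin.ext_iff]; omega

/-- The controlled-`Z` gate on qubits `i` and `j`. -/
def siteCZ {n : ℕ} (i j : Fin n) : Matrix (Fin (2 ^ n)) (Fin (2 ^ n)) ℂ :=
  (1 / 2 : ℂ) • (1 + site i PZ + site j PZ - site i PZ * site j PZ)

theorem embed_two (a b : ℕ) (P Q : Matrix (Fin 2) (Fin 2) ℂ) :
    embed a 2 b (a + 2 + b) rfl (tensorPow 2 ![P, Q]) =
      site ⟨a, by omega⟩ P * site ⟨a + 1, by omega⟩ Q := by
  rw [embed_tensorPow, site_eq_tensorPow, site_eq_tensorPow, ← tensorPow_mul]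
  congr 1
  funext i
  rcases exists_fin_add_add i with ⟨i, rfl⟩ | ⟨i, rfl⟩ | ⟨i, rfl⟩
  · rw [Fin.append_left, Fin.append_left, Pi.mul_apply, Pi.mulSingle_eq_of_ne,
      Pi.mulSingle_eq_of_ne, mul_one, Pi.one_apply]
    all_goals simp [Fin.ext_iff]; omega
  · rw [Fin.append_left, Fin.append_right]
    fin_cases i <;> simp [Pi.mulSingle_apply, Fin.ext_iff]
  · rw [Fin.append_right, Pi.mul_apply, Pi.mulSingle_eq_of_ne,
      Pi.mulSingle_eq_of_ne, mul_one, Pi.one_apply]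
    all_goals simp [Fin.ext_iff]; omega

theorem embed_gCZ {n : ℕ} (a b : ℕ) (h : a + 2 + b = n) :
    embed a 2 b n h gCZ = siteCZ ⟨a, by omega⟩ ⟨a + 1, by omega⟩ := by
  subst h
  have hg : gCZ = (1 / 2 : ℂ) • (tensorPow 2 ![1, 1] + tensorPow 2 ![PZ, 1] +
      tensorPow 2 ![1, PZ] - tensorPow 2 ![PZ, PZ]) := by
    ext x y
    simp only [Matrix.smul_apply, Matrix.add_apply, Matrix.sub_apply, tensorPow_apply]
    fin_cases x <;> fin_cases y <;>
      simp [qubitDigit, Fin.prod_univ_two, gCZ, PZ] <;> norm_num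
  have hadd : ∀ A B, embed a 2 b (a + 2 + b) rfl (A + B) =
      embed a 2 b (a + 2 + b) rfl A + embed a 2 b (a + 2 + b) rfl B := fun A B => by
    ext x y
    simp [embed, kron', Matrix.kroneckerMap_apply]
    ring
  have hsmul : ∀ (r : ℂ) A, embed a 2 b (a + 2 + b) rfl (r • A) =
      r • embed a 2 b (a + 2 + b) rfl A := fun r A => by
    ext x y
    simp [embed, kron', Matrix.kroneckerMap_apply]
    ring
  conv_lhs => rw [hg]
  rw [sub_eq_add_neg, ← neg_one_smul ℂ (tensorPow 2 ![PZ, PZ])]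
  refine (hsmul _ _).trans ?_
  rw [hadd, hadd, hadd, hsmul]
  simp only [embed_two, map_one, one_mul, mul_one, siteCZ, neg_one_smul, ← sub_eq_add_neg]

/-- The four single-qubit Pauli matrices. -/
abbrev paulis : Set (Matrix (Fin 2) (Fin 2) ℂ) := {1, PX, PY, PZ}

theorem PX_mul_PX : PX * PX = 1 := by simp [PX, Matrix.one_fin_two]

theorem PY_mul_PY : PY * PY = 1 := by simp [PY, Matrix.one_fin_two]

theorem PZ_mul_PZ : PZ * PZ = 1 := by simp [PZ, Matrix.one_fin_two]

theorem PX_mul_PY : PX * PY = Complex.I • PZ := by simp [PX, PY, PZ]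

theorem PY_mul_PX : PY * PX = (-Complex.I) • PZ := by simp [PX, PY, PZ]

theorem PY_mul_PZ : PY * PZ = Complex.I • PX := by simp [PX, PY, PZ]

theorem PZ_mul_PY : PZ * PY = (-Complex.I) • PX := by simp [PX, PY, PZ]

theorem PZ_mul_PX : PZ * PX = Complex.I • PY := by simp [PX, PY, PZ]

theorem PX_mul_PZ : PX * PZ = (-Complex.I) • PY := by simp [PX, PY, PZ]

theorem gH_mul_PX : gH * PX = PZ * gH := by simp [gH, PX, PZ]

theorem gH_mul_PY : gH * PY = -PY * gH := by simp [gH, PY, mul_comm]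

theorem gH_mul_PZ : gH * PZ = PX * gH := by simp [gH, PX, PZ]

theorem gS_mul_PX : gS * PX = PY * gS := by simp [gS, PX, PY]

theorem gS_mul_PY : gS * PY = -PX * gS := by simp [gS, PX, PY]

theorem gS_mul_PZ : gS * PZ = PZ * gS := by simp [gS, PZ]

theorem gH_pow_four : gH ^ 4 = 1 := by
  have h : gH * gH = 1 := by
    have : ((Real.sqrt 2 : ℂ))⁻¹ * (Real.sqrt 2 : ℂ)⁻¹ = 1 / 2 := by
      rw [← mul_inv, ← Complex.ofReal_mul, Real.mul_self_sqrt zero_le_two]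
      norm_num
    rw [gH, Matrix.smul_mul, Matrix.mul_smul, smul_smul, this]
    ext i j
    fin_cases i <;> fin_cases j <;> simp <;> norm_num
  rw [show gH ^ 4 = (gH * gH) * (gH * gH) by noncomm_ring, h, one_mul]

theorem gS_pow_four : gS ^ 4 = 1 := by
  rw [show gS ^ 4 = (gS * gS) * (gS * gS) by noncomm_ring]
  simp [gS, Matrix.one_fin_two]

theorem pow_four_eq_one_iff {c : ℂ} :
    c ^ 4 = 1 ↔ c ∈ ({1, -1, Complex.I, -Complex.I} : Set ℂ) := by
  have h : c ^ 4 - 1 = (c - 1) * (c + 1) * ((c - Complex.I) * (c + Complex.I)) := by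
    linear_combination (c ^ 2 - 1) * Complex.I_sq
  rw [← sub_eq_zero, h]
  simp [sub_eq_zero, add_eq_zero_iff_eq_neg, or_assoc]

/-- The single-qubit Pauli matrices with phases, as a predicate. -/
def IsLocalPauli (A : Matrix (Fin 2) (Fin 2) ℂ) : Prop :=
  ∃ c : ℂ, c ^ 4 = 1 ∧ ∃ p ∈ paulis, A = c • p

theorem IsLocalPauli.of_mem {p : Matrix (Fin 2) (Fin 2) ℂ} (hp : p ∈ paulis) : IsLocalPauli p :=
  ⟨1, one_pow _, p, hp, (one_smul _ _).symm⟩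

theorem IsLocalPauli.smul {A : Matrix (Fin 2) (Fin 2) ℂ} (hA : IsLocalPauli A) {c : ℂ}
    (hc : c ^ 4 = 1) : IsLocalPauli (c • A) := by
  obtain ⟨d, hd, p, hp, rfl⟩ := hA
  exact ⟨c * d, by rw [mul_pow, hc, hd, one_mul], p, hp, smul_smul _ _ _⟩

theorem IsLocalPauli.neg {A : Matrix (Fin 2) (Fin 2) ℂ} (hA : IsLocalPauli A) :
    IsLocalPauli (-A) := by
  simpa using hA.smul (c := -1) (by norm_num)

theorem IsLocalPauli.mul {A B : Matrix (Fin 2) (Fin 2) ℂ} (hA : IsLocalPauli A)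
    (hB : IsLocalPauli B) : IsLocalPauli (A * B) := by
  obtain ⟨c, hc, p, hp, rfl⟩ := hA
  obtain ⟨d, hd, q, hq, rfl⟩ := hB
  rw [Matrix.smul_mul, Matrix.mul_smul]
  refine IsLocalPauli.smul (IsLocalPauli.smul ?_ hd) hc
  have h1 : IsLocalPauli 1 := .of_mem (by simp)
  have hX : IsLocalPauli PX := .of_mem (by simp)
  have hY : IsLocalPauli PY := .of_mem (by simp)
  have hZ : IsLocalPauli PZ := .of_mem (by simp)
  have hI : Complex.I ^ 4 = 1 := Complex.I_pow_four
  have hI' : (-Complex.I) ^ 4 = 1 := by rw [neg_pow, hI]; norm_num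
  rcases hp with rfl | rfl | rfl | rfl <;> rcases hq with rfl | rfl | rfl | rfl <;>
    simp only [one_mul, mul_one, PX_mul_PX, PY_mul_PY, PZ_mul_PZ, PX_mul_PY, PY_mul_PX,
      PY_mul_PZ, PZ_mul_PY, PZ_mul_PX, PX_mul_PZ] <;>
    first
    | assumption
    | exact IsLocalPauli.smul ‹_› hI
    | exact IsLocalPauli.smul ‹_› hI'

theorem smul_tensorPow_mem_pauliSet {n : ℕ} {c : ℂ} (hc : c ^ 4 = 1)
    {P : Fin n → Matrix (Fin 2) (Fin 2) ℂ} (hP : ∀ i, IsLocalPauli (P i)) :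
    c • tensorPow n P ∈ PauliSet n := by
  choose d hd p hp h using hP
  refine ⟨c * ∏ i, d i, p, pow_four_eq_one_iff.mp ?_, hp, ?_⟩
  · simp [mul_pow, hc, ← Finset.prod_pow, hd]
  · rw [funext h, tensorPow_smul, smul_smul]

theorem mul_mem_pauliSet {n : ℕ} {M N : Matrix (Fin (2 ^ n)) (Fin (2 ^ n)) ℂ}
    (hM : M ∈ PauliSet n) (hN : N ∈ PauliSet n) : M * N ∈ PauliSet n := by
  obtain ⟨c, P, hc, hP, rfl⟩ := hM
  obtain ⟨d, Q, hd, hQ, rfl⟩ := hN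
  rw [Matrix.smul_mul, Matrix.mul_smul, smul_smul, ← tensorPow_mul]
  exact smul_tensorPow_mem_pauliSet
    (by rw [mul_pow, pow_four_eq_one_iff.mpr hc, pow_four_eq_one_iff.mpr hd, one_mul])
    fun i => (IsLocalPauli.of_mem (hP i)).mul (.of_mem (hQ i))

theorem site_mem_pauliSet {n : ℕ} (k : Fin n) {A : Matrix (Fin 2) (Fin 2) ℂ}
    (hA : IsLocalPauli A) : site k A ∈ PauliSet n := by
  rw [← one_smul ℂ (site k A), site_eq_tensorPow]
  refine smul_tensorPow_mem_pauliSet (one_pow _) fun i => ?_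
  rcases eq_or_ne i k with rfl | hi
  · simpa using hA
  · simpa [hi] using IsLocalPauli.of_mem (p := 1) (by simp)

theorem site_PZ_mul_self {n : ℕ} (k : Fin n) : site k PZ * site k PZ = 1 := by
  rw [← map_mul, PZ_mul_PZ, map_one]

theorem site_PZ_commute {n : ℕ} (i j : Fin n) : Commute (site i PZ) (site j PZ) := by
  rcases eq_or_ne i j with rfl | h
  · exact Commute.refl _
  · exact site_commute h _ _

theorem siteCZ_comm {n : ℕ} (i j : Fin n) : siteCZ i j = siteCZ j i := by
  rw [siteCZ, siteCZ, (site_PZ_commute i j).eq, add_right_comm]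

theorem commute_siteCZ {n : ℕ} {i j : Fin n} {M : Matrix (Fin (2 ^ n)) (Fin (2 ^ n)) ℂ}
    (hi : Commute (site i PZ) M) (hj : Commute (site j PZ) M) : Commute (siteCZ i j) M :=
  ((((Commute.one_left M).add_left hi).add_left hj).sub_left (hi.mul_left hj)).smul_left _

theorem siteCZ_commute_site {n : ℕ} {i j k : Fin n} (hi : i ≠ k) (hj : j ≠ k)
    (A : Matrix (Fin 2) (Fin 2) ℂ) : Commute (siteCZ i j) (site k A) :=
  commute_siteCZ (site_commute hi _ _) (site_commute hj _ _)

theorem siteCZ_commute_site_PZ {n : ℕ} (i j k : Fin n) : Commute (siteCZ i j) (site k PZ) :=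
  commute_siteCZ (site_PZ_commute _ _) (site_PZ_commute _ _)

theorem siteCZ_pow_four {n : ℕ} (i j : Fin n) : siteCZ i j ^ 4 = 1 := by
  have h : siteCZ i j * siteCZ i j = 1 := by
    have hi := site_PZ_mul_self i
    have hj := site_PZ_mul_self j
    have hc := (site_PZ_commute j i).eq
    have key : ∀ {R : Type} [Ring R] (u v : R), u * u = 1 → v * v = 1 → v * u = u * v →
        (1 + u + v - u * v) * (1 + u + v - u * v) = 1 + 1 + 1 + 1 := by
      intro R _ u v hu hv huv
      have h1 : u * (u * v) = v := by rw [← mul_assoc, hu, one_mul]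
      have h2 : v * (u * v) = u := by rw [← mul_assoc, huv, mul_assoc, hv, mul_one]
      simp only [add_mul, mul_add, sub_mul, mul_sub, one_mul, mul_one, hu, hv, huv, mul_assoc,
        h1, h2]
      abel
    rw [siteCZ, Matrix.smul_mul, Matrix.mul_smul, key _ _ hi hj hc, smul_smul]
    simp only [smul_add, ← add_smul]
    norm_num
  rw [show siteCZ i j ^ 4 = (siteCZ i j * siteCZ i j) * (siteCZ i j * siteCZ i j) by
    noncomm_ring, h, one_mul]

theorem siteCZ_mul_site_left {n : ℕ} {i j : Fin n} (hij : i ≠ j) {A : Matrix (Fin 2) (Fin 2) ℂ}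
    (hA : PZ * A = -(A * PZ)) :
    siteCZ i j * site i A = site i A * site j PZ * siteCZ i j := by
  have key : ∀ {R : Type} [Ring R] (u v x : R), v * v = 1 → v * u = u * v → v * x = x * v →
      u * x = -(x * u) → (1 + u + v - u * v) * x = x * v * (1 + u + v - u * v) := by
    intro R _ u v x hv huv hvx hux
    have h1 : v * (u * v) = u := by rw [← mul_assoc, huv, mul_assoc, hv, mul_one]
    have h2 : u * (x * v) = -(x * (u * v)) := by rw [← mul_assoc, hux, neg_mul, mul_assoc]
    simp only [add_mul, mul_add, sub_mul, mul_sub, one_mul, mul_one, hv, huv, hvx, hux,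
      mul_assoc, h1, h2]
    abel
  rw [siteCZ, Matrix.smul_mul, Matrix.mul_smul]
  congr 1
  refine key _ _ _ (site_PZ_mul_self j) (site_PZ_commute j i) (site_commute hij.symm _ _) ?_
  rw [← map_mul, hA, site_neg, map_mul]

theorem siteCZ_mul_site_right {n : ℕ} {i j : Fin n} (hij : i ≠ j)
    {A : Matrix (Fin 2) (Fin 2) ℂ} (hA : PZ * A = -(A * PZ)) :
    siteCZ i j * site j A = site j A * site i PZ * siteCZ i j := by
  rw [siteCZ_comm, siteCZ_mul_site_left hij.symm hA]

theorem commute_PZ_or_anticommute {p : Matrix (Fin 2) (Fin 2) ℂ} (hp : p ∈ paulis) :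
    (p = 1 ∨ p = PZ) ∨ ((p = PX ∨ p = PY) ∧ PZ * p = -(p * PZ)) := by
  rcases hp with rfl | rfl | rfl | rfl
  · simp
  · simp [PX_mul_PZ, PZ_mul_PX]
  · simp [PY_mul_PZ, PZ_mul_PY]
  · simp

theorem exists_siteCZ_mul_site {n : ℕ} {i j : Fin n} (hij : i ≠ j)
    {p : Matrix (Fin 2) (Fin 2) ℂ} (hp : p ∈ paulis) :
    ∃ z ∈ paulis, siteCZ i j * site i p = site i p * site j z * siteCZ i j := by
  rcases commute_PZ_or_anticommute hp with (rfl | rfl) | ⟨-, h⟩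
  · exact ⟨1, by simp, by simp⟩
  · exact ⟨1, by simp, by rw [map_one, mul_one, (siteCZ_commute_site_PZ i j i).eq]⟩
  · exact ⟨PZ, by simp, siteCZ_mul_site_left hij h⟩

/-- The Hadamard, phase and controlled-`Z` gates on `n` qubits. -/
def cliffordGates (n : ℕ) : Set (Matrix (Fin (2 ^ n)) (Fin (2 ^ n)) ℂ) :=
  {M | (∃ k, M = site k gH ∨ M = site k gS) ∨ ∃ i j : Fin n, (j : ℕ) = i + 1 ∧ M = siteCZ i j}

theorem exists_unit_of_mem_cliffordGates {n : ℕ} {M : Matrix (Fin (2 ^ n)) (Fin (2 ^ n)) ℂ}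
    (hM : M ∈ Submonoid.closure (cliffordGates n)) :
    ∃ U ∈ CliffordGroup n, (U : Matrix (Fin (2 ^ n)) (Fin (2 ^ n)) ℂ) = M := by
  induction hM using Submonoid.closure_induction with
  | one => exact ⟨1, one_mem _, rfl⟩
  | mul x y _ _ hx hy =>
    obtain ⟨U, hU, rfl⟩ := hx
    obtain ⟨V, hV, rfl⟩ := hy
    exact ⟨U * V, mul_mem hU hV, rfl⟩
  | mem M hM =>
    have h4 : M ^ 4 = 1 := by
      rcases hM with ⟨k, rfl | rfl⟩ | ⟨i, j, -, rfl⟩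
      · rw [← map_pow, gH_pow_four, map_one]
      · rw [← map_pow, gS_pow_four, map_one]
      · exact siteCZ_pow_four i j
    refine ⟨⟨M, M ^ 3, by rw [← pow_succ', h4], by rw [← pow_succ, h4]⟩,
      Subgroup.subset_closure ?_, rfl⟩
    change M ∈ CliffordGenSet n
    rcases hM with ⟨⟨k, hk⟩, h⟩ | ⟨⟨i, hi⟩, ⟨j, hj⟩, hij, rfl⟩
    · refine .inl (.inr ⟨k, n - k - 1, by omega, ?_⟩)
      rwa [embed_one, embed_one]
    · obtain rfl : j = i + 1 := hij
      exact .inr ⟨i, n - i - 2, by omega, (embed_gCZ _ _ _).symm⟩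

theorem exists_pauli_of_mem_cliffordGates {n : ℕ} {C M : Matrix (Fin (2 ^ n)) (Fin (2 ^ n)) ℂ}
    (hC : C ∈ Submonoid.closure (cliffordGates n)) (hM : M ∈ PauliSet n) :
    ∃ M' ∈ PauliSet n, C * M = M' * C := by
  induction hC using Submonoid.closure_induction generalizing M with
  | one => exact ⟨M, hM, by simp⟩
  | mul x y _ _ hx hy =>
    obtain ⟨M₁, h₁, e₁⟩ := hy hM
    obtain ⟨M₂, h₂, e₂⟩ := hx h₁
    exact ⟨M₂, h₂, by rw [mul_assoc, e₁, ← mul_assoc, e₂, mul_assoc]⟩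
  | mem C hC =>
    obtain ⟨c, P, hc, hP, rfl⟩ := hM
    rw [← pow_four_eq_one_iff] at hc
    have local_gate : ∀ (k : Fin n) (g : Matrix (Fin 2) (Fin 2) ℂ),
        (∃ p, IsLocalPauli p ∧ g * P k = p * g) →
        ∃ M' ∈ PauliSet n, site k g * (c • tensorPow n P) = M' * site k g := by
      rintro k g ⟨p, hp, h⟩
      refine ⟨c • tensorPow n (Function.update P k p),
        smul_tensorPow_mem_pauliSet hc fun i => ?_, ?_⟩
      · rcases eq_or_ne i k with rfl | hi
        · simpa using hp
        · simpa [hi] using IsLocalPauli.of_mem (hP i)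
      · rw [Matrix.mul_smul, Matrix.smul_mul, site_eq_tensorPow, ← tensorPow_mul, ← tensorPow_mul]
        congr 2
        funext i
        rcases eq_or_ne i k with rfl | hi
        · simpa using h
        · simp [hi]
    have h1 : IsLocalPauli 1 := .of_mem (by simp)
    have hX : IsLocalPauli PX := .of_mem (by simp)
    have hY : IsLocalPauli PY := .of_mem (by simp)
    have hZ : IsLocalPauli PZ := .of_mem (by simp)
    rcases hC with ⟨k, rfl | rfl⟩ | ⟨i, j, hij, rfl⟩
    · apply local_gate
      rcases hP k with h | h | h | h <;> rw [h]
      · exact ⟨1, h1, by simp⟩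
      · exact ⟨PZ, hZ, gH_mul_PX⟩
      · exact ⟨-PY, hY.neg, gH_mul_PY⟩
      · exact ⟨PX, hX, gH_mul_PZ⟩
    · apply local_gate
      rcases hP k with h | h | h | h <;> rw [h]
      · exact ⟨1, h1, by simp⟩
      · exact ⟨PY, hY, gS_mul_PX⟩
      · exact ⟨-PX, hX.neg, gS_mul_PY⟩
      · exact ⟨PZ, hZ, gS_mul_PZ⟩
    · have hne : i ≠ j := fun h => by simp [h] at hij
      obtain ⟨z, hz, ez⟩ := exists_siteCZ_mul_site hne (hP i)
      obtain ⟨w, hw, ew⟩ := exists_siteCZ_mul_site hne.symm (hP j)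
      rw [siteCZ_comm] at ew
      set P₁ := Function.update P j 1 with hP₁
      have e₁ : P₁ i = P i := by simp [hP₁, hne]
      set P₀ := Function.update P₁ i 1 with hP₀
      have hcomm : Commute (siteCZ i j) (tensorPow n P₀) :=
        commute_siteCZ (tensorPow_commute_site (by simp [hP₀])).symm
          (tensorPow_commute_site (by simp [hP₀, hP₁, hne.symm])).symm
      refine ⟨c • tensorPow n P₀ * (site i (P i) * site j z) * (site j (P j) * site i w), ?_, ?_⟩
      · refine mul_mem_pauliSet (mul_mem_pauliSet (smul_tensorPow_mem_pauliSet hc fun l => ?_) ?_) ?_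
        · rw [hP₀, hP₁]
          rcases eq_or_ne l i with rfl | hi
          · simpa using h1
          rcases eq_or_ne l j with rfl | hj
          · simpa [hi] using h1
          · simpa [hi, hj] using IsLocalPauli.of_mem (hP l)
        · exact mul_mem_pauliSet (site_mem_pauliSet _ (.of_mem (hP i)))
            (site_mem_pauliSet _ (.of_mem hz))
        · exact mul_mem_pauliSet (site_mem_pauliSet _ (.of_mem (hP j)))
            (site_mem_pauliSet _ (.of_mem hw))
      · rw [tensorPow_eq_update_mul_site P j, ← hP₁, tensorPow_eq_update_mul_site P₁ i, ← hP₀, e₁]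
        simp only [Matrix.smul_mul, Matrix.mul_smul]
        congr 1
        rw [← mul_assoc, ← mul_assoc, hcomm.eq, mul_assoc (tensorPow n P₀), ez]
        simp only [mul_assoc] at ew ⊢
        rw [ew]

/-- Single-qubit matrices generated by the Hadamard and phase gates. -/
abbrev localGates : Submonoid (Matrix (Fin 2) (Fin 2) ℂ) := Submonoid.closure {gH, gS}

theorem site_mem_closure_cliffordGates {n : ℕ} (k : Fin n) {g : Matrix (Fin 2) (Fin 2) ℂ}
    (hg : g ∈ localGates) : site k g ∈ Submonoid.closure (cliffordGates n) := by
  have h : localGates ≤ (Submonoid.closure (cliffordGates n)).comap (site k) := by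
    rw [Submonoid.closure_le]
    rintro g (rfl | rfl)
    · exact Submonoid.subset_closure (.inl ⟨k, .inl rfl⟩)
    · exact Submonoid.subset_closure (.inl ⟨k, .inr rfl⟩)
  exact h hg

/-- Some product of Hadamard and phase gates conjugates `A` to `B`. -/
def LocalConj (A B : Matrix (Fin 2) (Fin 2) ℂ) : Prop := ∃ g ∈ localGates, g * A = B * g

theorem LocalConj.trans {A B C : Matrix (Fin 2) (Fin 2) ℂ} (h : LocalConj A B)
    (h' : LocalConj B C) : LocalConj A C := by
  obtain ⟨g, hg, e⟩ := h
  obtain ⟨g', hg', e'⟩ := h'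
  exact ⟨g' * g, mul_mem hg' hg, by rw [mul_assoc, e, ← mul_assoc, e', mul_assoc]⟩

theorem localConj_gH {A B : Matrix (Fin 2) (Fin 2) ℂ} (h : gH * A = B * gH) : LocalConj A B :=
  ⟨gH, Submonoid.subset_closure (by simp), h⟩

/-- Some power of the phase gate conjugates `± X` and `± Y` to `X`. -/
theorem exists_phase_conj_PX {c : ℂ} (hc : c = 1 ∨ c = -1) {p : Matrix (Fin 2) (Fin 2) ℂ}
    (hp : p = PX ∨ p = PY) :
    ∃ g ∈ localGates, Commute g PZ ∧ g * (c • p) = PX * g := by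
  have hS : gS ∈ localGates := Submonoid.subset_closure (by simp)
  have hpow : ∀ m : ℕ, gS ^ m ∈ localGates ∧ Commute (gS ^ m) PZ := fun m =>
    ⟨pow_mem hS m, Commute.pow_left gS_mul_PZ m⟩
  have h1 : gS ^ 1 * (-PY) = PX * gS ^ 1 := by
    rw [pow_one, mul_neg, gS_mul_PY, neg_mul, neg_neg]
  have h2 : gS ^ 2 * (-PX) = PX * gS ^ 2 := by
    rw [pow_succ, mul_assoc, mul_neg, gS_mul_PX, ← neg_mul, ← mul_assoc, h1, mul_assoc, pow_one]
  have h3 : gS ^ 3 * PY = PX * gS ^ 3 := by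
    rw [pow_succ, mul_assoc, gS_mul_PY, ← mul_assoc, h2, mul_assoc]
  rcases hc with rfl | rfl <;> rcases hp with rfl | rfl
  · exact ⟨1, one_mem _, Commute.one_left _, by simp⟩
  · exact ⟨gS ^ 3, (hpow 3).1, (hpow 3).2, by simpa using h3⟩
  · exact ⟨gS ^ 2, (hpow 2).1, (hpow 2).2, by simpa using h2⟩
  · exact ⟨gS ^ 1, (hpow 1).1, (hpow 1).2, by simpa using h1⟩

theorem localConj_PX {c : ℂ} (hc : c = 1 ∨ c = -1) {p : Matrix (Fin 2) (Fin 2) ℂ}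
    (hp : p ∈ paulis) (h1 : p ≠ 1) : LocalConj (c • p) PX := by
  have hXY : ∀ q, (q = PX ∨ q = PY) → LocalConj (c • q) PX := fun q hq =>
    let ⟨g, hg, _, h⟩ := exists_phase_conj_PX hc hq
    ⟨g, hg, h⟩
  rcases hp with rfl | rfl | rfl | rfl
  · exact absurd rfl h1
  · exact hXY _ (.inl rfl)
  · exact hXY _ (.inr rfl)
  · exact (localConj_gH (by rw [Matrix.mul_smul, gH_mul_PZ, Matrix.smul_mul])).trans
      (hXY _ (.inl rfl))

/-- Some product of Clifford gates that commutes with all of `T` conjugates `A` to `B`. -/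
def CliffConj {n : ℕ} (T : Set (Matrix (Fin (2 ^ n)) (Fin (2 ^ n)) ℂ))
    (A B : Matrix (Fin (2 ^ n)) (Fin (2 ^ n)) ℂ) : Prop :=
  ∃ C ∈ Submonoid.closure (cliffordGates n), (∀ t ∈ T, Commute C t) ∧ C * A = B * C

theorem CliffConj.trans {n : ℕ} {T : Set (Matrix (Fin (2 ^ n)) (Fin (2 ^ n)) ℂ)}
    {A B C : Matrix (Fin (2 ^ n)) (Fin (2 ^ n)) ℂ} (h : CliffConj T A B)
    (h' : CliffConj T B C) : CliffConj T A C := by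
  obtain ⟨g, hg, hT, e⟩ := h
  obtain ⟨g', hg', hT', e'⟩ := h'
  exact ⟨g' * g, mul_mem hg' hg, fun t ht => (hT' t ht).mul_left (hT t ht),
    by rw [mul_assoc, e, ← mul_assoc, e', mul_assoc]⟩

theorem CliffConj.mono {n : ℕ} {T T' : Set (Matrix (Fin (2 ^ n)) (Fin (2 ^ n)) ℂ)}
    {A B : Matrix (Fin (2 ^ n)) (Fin (2 ^ n)) ℂ} (h : CliffConj T A B) (hT : T' ⊆ T) :
    CliffConj T' A B :=
  let ⟨g, hg, hc, e⟩ := h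
  ⟨g, hg, fun t ht => hc t (hT ht), e⟩

theorem CliffConj.mul_right {n : ℕ} {T : Set (Matrix (Fin (2 ^ n)) (Fin (2 ^ n)) ℂ)}
    {A B D : Matrix (Fin (2 ^ n)) (Fin (2 ^ n)) ℂ} (h : CliffConj T A B) (hD : D ∈ T) :
    CliffConj T (A * D) (B * D) :=
  let ⟨g, hg, hc, e⟩ := h
  ⟨g, hg, hc, by rw [← mul_assoc, e, mul_assoc, (hc D hD).eq, mul_assoc]⟩

/-- The operators acting on a single one of the qubits beyond the `k`-th. -/
def sitesAfter (n k : ℕ) : Set (Matrix (Fin (2 ^ n)) (Fin (2 ^ n)) ℂ) :=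
  {M | ∃ (j : Fin n) (A : Matrix (Fin 2) (Fin 2) ℂ), k < j ∧ M = site j A}

theorem sitesAfter_anti {n k l : ℕ} (h : k ≤ l) : sitesAfter n l ⊆ sitesAfter n k := by
  rintro _ ⟨j, A, hj, rfl⟩
  exact ⟨j, A, h.trans_lt hj, rfl⟩

theorem LocalConj.site_left {n : ℕ} {A B : Matrix (Fin 2) (Fin 2) ℂ} (h : LocalConj A B)
    {i : Fin n} {k : ℕ} (hik : i ≤ k) {j : Fin n} (hij : i ≠ j) (D : Matrix (Fin 2) (Fin 2) ℂ) :
    CliffConj (sitesAfter n k) (site i A * site j D) (site i B * site j D) := by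
  obtain ⟨g, hg, e⟩ := h
  refine ⟨site i g, site_mem_closure_cliffordGates i hg, ?_, ?_⟩
  · rintro _ ⟨l, C, hl, rfl⟩
    exact site_commute (fun h => by subst h; omega) _ _
  · rw [← mul_assoc, ← map_mul, e, map_mul, mul_assoc, (site_commute hij g D).eq, mul_assoc]

theorem LocalConj.site_right {n : ℕ} {A B : Matrix (Fin 2) (Fin 2) ℂ} (h : LocalConj A B)
    {i : Fin n} {k : ℕ} (hik : i ≤ k) {j : Fin n} (hij : i ≠ j) (D : Matrix (Fin 2) (Fin 2) ℂ) :
    CliffConj (sitesAfter n k) (site j D * site i A) (site j D * site i B) := by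
  rw [(site_commute hij.symm D A).eq, (site_commute hij.symm D B).eq]
  exact h.site_left hik hij D

theorem LocalConj.site {n : ℕ} {A B : Matrix (Fin 2) (Fin 2) ℂ} (h : LocalConj A B)
    {i : Fin n} {k : ℕ} (hik : i ≤ k) : CliffConj (sitesAfter n k) (site i A) (site i B) := by
  obtain ⟨g, hg, e⟩ := h
  refine ⟨_root_.site i g, site_mem_closure_cliffordGates i hg, ?_, ?_⟩
  · rintro _ ⟨l, C, hl, rfl⟩
    exact site_commute (fun h => by subst h; omega) _ _
  · rw [← map_mul, e, map_mul]

theorem PZ_mul_PX_anti : PZ * PX = -(PX * PZ) := by simp [PX_mul_PZ, PZ_mul_PX]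

theorem siteCZ_mul_PZ_PX {n : ℕ} {i j : Fin n} (hij : i ≠ j) :
    siteCZ i j * (site i PZ * site j PX) = site j PX * siteCZ i j := by
  rw [← mul_assoc, (siteCZ_commute_site_PZ i j i).eq, mul_assoc,
    siteCZ_mul_site_right hij PZ_mul_PX_anti, (site_commute hij.symm PX PZ).eq, ← mul_assoc,
    ← mul_assoc, site_PZ_mul_self, one_mul]

theorem cliffConj_siteCZ {n : ℕ} {i j : Fin n} (hij : (j : ℕ) = i + 1)
    {A B : Matrix (Fin (2 ^ n)) (Fin (2 ^ n)) ℂ} (h : siteCZ i j * A = B * siteCZ i j) :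
    CliffConj (sitesAfter n j) A B := by
  refine ⟨siteCZ i j, Submonoid.subset_closure (.inr ⟨i, j, hij, rfl⟩), ?_, h⟩
  rintro _ ⟨l, C, hl, rfl⟩
  exact siteCZ_commute_site (fun h => by subst h; omega) (fun h => by subst h; omega) _

theorem cliffConj_PZ_mul {n : ℕ} {i j : Fin n} (hij : (j : ℕ) = i + 1)
    {p : Matrix (Fin 2) (Fin 2) ℂ} (hp : p ∈ paulis) :
    CliffConj (sitesAfter n j) (site i PZ * site j p) (site j PZ) := by
  have hne : i ≠ j := fun h => by simp [h] at hij
  have hle : (i : ℕ) ≤ j := by omega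
  have key : CliffConj (sitesAfter n j) (site i PZ * site j PX) (site j PZ) :=
    (cliffConj_siteCZ hij (siteCZ_mul_PZ_PX hne)).trans ((localConj_gH gH_mul_PX).site le_rfl)
  by_cases h1 : p = 1
  · subst h1
    refine ((localConj_gH gH_mul_PZ).site_left hle hne _).trans (CliffConj.trans ?_
      (((localConj_gH gH_mul_PX).site_left hle hne PZ).trans
        (((localConj_gH gH_mul_PZ).site_right le_rfl hne.symm _).trans key)))
    rw [map_one, mul_one]
    exact cliffConj_siteCZ hij (siteCZ_mul_site_left hne PZ_mul_PX_anti)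
  · have := localConj_PX (.inl rfl) hp h1
    rw [one_smul] at this
    exact (this.site_right le_rfl hne.symm _).trans key

theorem smul_tensorPow_eq_site {n : ℕ} (c : ℂ) {P : Fin n → Matrix (Fin 2) (Fin 2) ℂ} {k : Fin n}
    (hP : ∀ i ≠ k, P i = 1) : c • tensorPow n P = site k (c • P k) := by
  rw [site_smul, site_eq_tensorPow]
  congr 2
  funext i
  rcases eq_or_ne i k with rfl | hi
  · simp
  · simp [hi, hP i hi]

/-- A nontrivial Pauli operator supported on the qubits up to the `k`-th is conjugate to `Z` on the
`k`-th qubit by a Clifford operator acting on these qubits only. -/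
theorem cliffConj_site_PZ {n : ℕ} {c : ℂ} (hc : c = 1 ∨ c = -1) {k : ℕ} (hk : k < n)
    {P : Fin n → Matrix (Fin 2) (Fin 2) ℂ} (hP : ∀ i, P i ∈ paulis)
    (hsupp : ∀ i : Fin n, k < i → P i = 1) (hne : ∃ i, P i ≠ 1) :
    CliffConj (sitesAfter n k) (c • tensorPow n P) (site ⟨k, hk⟩ PZ) := by
  have single : ∀ (k : Fin n) (P : Fin n → Matrix (Fin 2) (Fin 2) ℂ), (∀ i, P i ∈ paulis) →
      (∃ i, P i ≠ 1) → (∀ i ≠ k, P i = 1) →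
      CliffConj (sitesAfter n k) (c • tensorPow n P) (site k PZ) := by
    rintro k P hP ⟨i, hi⟩ hk
    obtain rfl : i = k := by_contra fun h => hi (hk i h)
    rw [smul_tensorPow_eq_site c hk]
    exact ((localConj_PX hc (hP i) hi).trans (localConj_gH gH_mul_PX)).site le_rfl
  induction k generalizing P with
  | zero =>
    exact single ⟨0, hk⟩ P hP hne fun i hi =>
      hsupp i (Nat.pos_of_ne_zero fun h => hi (Fin.ext h))
  | succ k ih =>
    set j : Fin n := ⟨k + 1, hk⟩ with hj
    by_cases hr : ∃ i, Function.update P j 1 i ≠ 1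
    · have h := ih (Nat.lt_of_succ_lt hk) (P := Function.update P j 1)
        (fun i => by
          rcases eq_or_ne i j with h | h
          · subst h; simp
          · simpa [h] using hP i)
        (fun i hi => by
          rcases eq_or_ne i j with h | h
          · subst h; simp
          · rw [Function.update_of_ne h]
            have : (i : ℕ) ≠ k + 1 := fun h' => h (Fin.ext h')
            exact hsupp i (by omega)) hr
      rw [tensorPow_eq_update_mul_site P j, ← Matrix.smul_mul]
      exact ((h.mul_right ⟨j, P j, Nat.lt_succ_self k, rfl⟩).mono
        (sitesAfter_anti (Nat.le_succ k))).trans (cliffConj_PZ_mul (j := j) rfl (hP j))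
    · push Not at hr
      exact single j P hP hne fun i hi => by simpa [hi] using hr i

/-- A Pauli operator whose `m`-th factor is `X` or `Y`, where `m` is the last qubit, is conjugate
to `X` on the last qubit by a Clifford operator commuting with `Z` on the last qubit. -/
theorem cliffConj_site_PX {n : ℕ} {c : ℂ} (hc : c = 1 ∨ c = -1) {m : Fin n}
    (hm : (m : ℕ) + 1 = n) {P : Fin n → Matrix (Fin 2) (Fin 2) ℂ} (hP : ∀ i, P i ∈ paulis)
    (hPm : P m = PX ∨ P m = PY) :
    CliffConj {site m PZ} (c • tensorPow n P) (site m PX) := by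
  by_cases hr : ∃ i, Function.update P m 1 i ≠ 1
  · obtain ⟨⟨i, hi⟩, hPi⟩ := hr
    have hmi : i ≠ m := fun h => hPi (by simp [h])
    obtain ⟨k, hk⟩ : ∃ k, (m : ℕ) = k + 1 := Nat.exists_eq_succ_of_ne_zero (by omega)
    have hkn : k < n := by omega
    have hne : (⟨k, hkn⟩ : Fin n) ≠ m := fun h => by simp [← h] at hk
    have hmem : ∀ A, site m A ∈ sitesAfter n k := fun A => ⟨m, A, by omega, rfl⟩
    have h := cliffConj_site_PZ hc hkn (P := Function.update P m 1)
      (fun i => by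
        rcases eq_or_ne i m with h | h
        · subst h; simp
        · simpa [h] using hP i)
      (fun i hi => by
        obtain rfl : i = m := Fin.ext (by omega)
        simp) ⟨_, hPi⟩
    rw [tensorPow_eq_update_mul_site P m, ← Matrix.smul_mul]
    refine ((h.mul_right (hmem _)).mono (Set.singleton_subset_iff.mpr (hmem _))).trans ?_
    obtain ⟨g, hg, hgZ, e⟩ := exists_phase_conj_PX (.inl rfl) hPm
    rw [one_smul] at e
    refine CliffConj.trans (B := site ⟨k, hkn⟩ PZ * site m PX)
      ⟨site m g, site_mem_closure_cliffordGates m hg, ?_, ?_⟩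
      ⟨siteCZ ⟨k, hkn⟩ m, Submonoid.subset_closure (.inr ⟨_, _, hk, rfl⟩), ?_,
        siteCZ_mul_PZ_PX hne⟩
    · rintro _ rfl
      exact hgZ.map (site m)
    · rw [← mul_assoc, (site_commute hne.symm g PZ).eq, mul_assoc, ← map_mul, e, map_mul,
        mul_assoc]
    · rintro _ rfl
      exact siteCZ_commute_site_PZ _ _ _
  · push Not at hr
    rw [smul_tensorPow_eq_site c fun i hi => by rw [← hr i, Function.update_of_ne hi]]
    obtain ⟨g, hg, hgZ, e⟩ := exists_phase_conj_PX hc hPm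
    refine ⟨site m g, site_mem_closure_cliffordGates m hg, ?_, by rw [← map_mul, e, map_mul]⟩
    rintro _ rfl
    exact hgZ.map (site m)

theorem not_commute_of_anticommute {n : ℕ} {P Q : Matrix (Fin (2 ^ n)) (Fin (2 ^ n)) ℂ}
    (hP : P * P = 1) (hQ : Q * Q = 1) (h : P * Q = -(Q * P)) : ¬ Commute P Q := by
  intro hc
  have h0 : P * Q = 0 := by
    rw [← hc.eq] at h
    ext i j
    exact self_eq_neg.mp (congrFun₂ h i j)
  have : (1 : Matrix (Fin (2 ^ n)) (Fin (2 ^ n)) ℂ) = 0 := by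
    rw [← hQ, ← one_mul Q, ← hP, mul_assoc P P Q, h0, mul_zero, zero_mul]
  exact one_ne_zero this

theorem eq_one_or_neg_one_of_mul_self {n : ℕ} {c : ℂ} {P : Fin n → Matrix (Fin 2) (Fin 2) ℂ}
    (hP : ∀ i, P i ∈ paulis) (h : (c • tensorPow n P) * (c • tensorPow n P) = 1) :
    c = 1 ∨ c = -1 := by
  have hPP : P * P = 1 := funext fun i => by
    rcases hP i with h | h | h | h <;> rw [Pi.mul_apply, h] <;>
      simp [PX_mul_PX, PY_mul_PY, PZ_mul_PZ]
  rw [Matrix.smul_mul, Matrix.mul_smul, ← tensorPow_mul, hPP, tensorPow_one, smul_smul] at h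
  have h00 := congrFun₂ h ⟨0, Nat.two_pow_pos n⟩ ⟨0, Nat.two_pow_pos n⟩
  exact mul_self_eq_one_iff.mp (by simpa using h00)

theorem tensorPow_ite_last {n : ℕ} (hn : 1 ≤ n) (A : Matrix (Fin 2) (Fin 2) ℂ) :
    (tensorPow n fun i => if i.val = n - 1 then A else 1) = site ⟨n - 1, by omega⟩ A := by
  rw [site_eq_tensorPow]
  congr 1
  funext i
  simp [Pi.mulSingle_apply, Fin.ext_iff]

/-- For n ≥ 1, any anticommuting pair of self-inverse Pauli operators
P, Q can be sent by a single Clifford conjugation to I ⊗ ⋯ ⊗ I ⊗ Z and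
I ⊗ ⋯ ⊗ I ⊗ X respectively. -/
theorem pauli_pair_to_ZX_last (n : ℕ) (hn : 1 ≤ n)
    (P Q : Matrix (Fin (2 ^ n)) (Fin (2 ^ n)) ℂ)
    (hP : P ∈ PauliSet n) (hQ : Q ∈ PauliSet n)
    (hP2 : P * P = 1) (hQ2 : Q * Q = 1)
    (hanti : P * Q = -(Q * P)) :
    ∃ C ∈ CliffordGroup n,
      (C : Matrix (Fin (2 ^ n)) (Fin (2 ^ n)) ℂ) * P *
        ((C⁻¹ : GL (Fin (2 ^ n)) ℂ) : Matrix (Fin (2 ^ n)) (Fin (2 ^ n)) ℂ)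
        = ZLast n ∧
      (C : Matrix (Fin (2 ^ n)) (Fin (2 ^ n)) ℂ) * Q *
        ((C⁻¹ : GL (Fin (2 ^ n)) ℂ) : Matrix (Fin (2 ^ n)) (Fin (2 ^ n)) ℂ)
        = XLast n := by
  have hZ : ZLast n = site ⟨n - 1, by omega⟩ PZ := tensorPow_ite_last hn PZ
  have hX : XLast n = site ⟨n - 1, by omega⟩ PX := tensorPow_ite_last hn PX
  rw [hZ, hX]
  set m : Fin n := ⟨n - 1, by omega⟩ with hm
  obtain ⟨C, hC, -, hCP⟩ : CliffConj (sitesAfter n m) P (site m PZ) := by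
    obtain ⟨c, p, -, hp, rfl⟩ := hP
    refine cliffConj_site_PZ (eq_one_or_neg_one_of_mul_self hp hP2) m.2 hp
      (fun i hi => by simp only [hm] at hi; omega) ?_
    by_contra! h1
    refine not_commute_of_anticommute hP2 hQ2 hanti ?_
    rw [show p = 1 from funext h1, tensorPow_one]
    exact (Commute.one_left Q).smul_left c
  obtain ⟨Q', hQ', hCQ⟩ := exists_pauli_of_mem_cliffordGates hC hQ
  obtain ⟨U, hU, rfl⟩ := exists_unit_of_mem_cliffordGates hC
  have hQ'2 : Q' * Q' = 1 := by
    refine U.isUnit.mul_right_cancel ?_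
    rw [mul_assoc, ← hCQ, ← mul_assoc, ← hCQ, mul_assoc, hQ2, mul_one, one_mul]
  have hanti' : site m PZ * Q' = -(Q' * site m PZ) := by
    refine U.isUnit.mul_right_cancel ?_
    rw [mul_assoc, ← hCQ, ← mul_assoc, ← hCP, mul_assoc, hanti, mul_neg, ← mul_assoc, hCQ,
      neg_mul, mul_assoc, mul_assoc, ← hCP]
  obtain ⟨D, hD, hDZ, hDQ⟩ : CliffConj {site m PZ} Q' (site m PX) := by
    obtain ⟨c, q, -, hq, rfl⟩ := hQ'
    refine cliffConj_site_PX (eq_one_or_neg_one_of_mul_self hq hQ'2)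
      (Nat.sub_add_cancel hn) hq ?_
    rcases commute_PZ_or_anticommute (hq m) with h | ⟨h, -⟩
    · refine absurd ?_ (not_commute_of_anticommute (site_PZ_mul_self m) hQ'2 hanti')
      refine ((tensorPow_commute_site ?_).smul_left c).symm
      rcases h with h | h <;> rw [h]
      exact Commute.one_left _
    · exact h
  obtain ⟨V, hV, rfl⟩ := exists_unit_of_mem_cliffordGates hD
  refine ⟨V * U, mul_mem hV hU, ?_, ?_⟩
  · rw [Units.mul_inv_eq_iff_eq_mul, Units.val_mul, mul_assoc, hCP, ← mul_assoc,
      (hDZ _ rfl).eq, mul_assoc]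
  · rw [Units.mul_inv_eq_iff_eq_mul, Units.val_mul, mul_assoc, hCQ, ← mul_assoc, hDQ, mul_assoc]
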